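/- Let g ∈ GL_{N+1}(k), let α = (α_0,…,α_N) ∈ ℤ^{N+1} \ {0} satisfy α_0 ≤ ⋯ ≤ α_N and Σ_{i=0}^N α_i = 0, and let s be an integer with −1 ≤ s ≤ N−2 such that the Krull dimension of k[X_0,…,X_N]/J is at most s+1 (i.e. dim(H_sing) ≤ s). Then (N − s − 2)·deg_α(F∘g) ≥ d·Σ_{i=1}^{N−s−2} α_i. -/

import Mathlib

open MvPolynomial

/-- The `α`-degree of a multivariate polynomial `G`: the maximum of `∑ i, m i * α i`
over the monomials `X^m` occurring in `G` with nonzero coefficient (0 if `G = 0`). -/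
noncomputable def adeg {k : Type*} [CommSemiring k] {n : ℕ} (α : Fin n → ℤ)
    (G : MvPolynomial (Fin n) k) : ℤ :=
  if h : G.support.Nonempty then G.support.sup' h (fun m => ∑ i, (m i : ℤ) * α i) else 0

/-- `F ∘ g`: the polynomial obtained from `F` by the substitution `X i ↦ ∑ j, g i j • X j`. -/
noncomputable def substGL {k : Type*} [CommRing k] {n : ℕ}
    (g : Matrix (Fin n) (Fin n) k) (F : MvPolynomial (Fin n) k) :
    MvPolynomial (Fin n) k :=
  aeval (fun i => ∑ j, C (g i j) * X j) F

/-- Dehomogenization with respect to the last variable: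
`G(X_0, …, X_N) ↦ G(x_0, …, x_{N-1}, 1)`. -/
noncomputable def dehom {k : Type*} [CommRing k] {N : ℕ}
    (G : MvPolynomial (Fin (N+1)) k) : MvPolynomial (Fin N) k :=
  aeval (fun i : Fin (N+1) => if h : (i : ℕ) < N then X ⟨i, h⟩ else 1) G

/-- `ord_0 f`: the minimal total degree of a monomial occurring in `f`
with nonzero coefficient (0 if `f = 0`). -/
noncomputable def ord0 {k : Type*} [CommSemiring k] {N : ℕ}
    (f : MvPolynomial (Fin N) k) : ℕ :=
  if h : f.support.Nonempty then f.support.inf' h (fun m => ∑ i, m i) else 0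

/-- The ideal generated by `F` and its partial derivatives, defining the singular
locus `H_sing` of the hypersurface `H = {F = 0}`. -/
noncomputable def jacobianIdeal {k : Type*} [CommRing k] {N : ℕ}
    (F : MvPolynomial (Fin (N+1)) k) : Ideal (MvPolynomial (Fin (N+1)) k) :=
  Ideal.span ({F} ∪ Set.range (fun i => pderiv i F))

/-- An ideal generated by a set of variables is prime. -/
theorem isPrime_span_X_image {σ k : Type*} [CommRing k] [IsDomain k] (s : Set σ) :
    (Ideal.span (X '' s : Set (MvPolynomial σ k))).IsPrime := by
  classical
  let φ : MvPolynomial σ k →ₐ[k] MvPolynomial σ k := aeval fun i => if i ∈ s then 0 else X i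
  have hφ : ∀ i, φ (X i) = if i ∈ s then 0 else X i := fun i => aeval_X _ _
  suffices h : Ideal.span (X '' s : Set (MvPolynomial σ k)) = RingHom.ker φ by
    rw [h]
    exact RingHom.ker_isPrime _
  apply le_antisymm
  · rw [Ideal.span_le]
    rintro _ ⟨i, hi, rfl⟩
    simp [RingHom.mem_ker, hφ, hi]
  · intro p hp
    have hmk : (Ideal.Quotient.mkₐ k (Ideal.span (X '' s : Set (MvPolynomial σ k)))).comp φ =
        Ideal.Quotient.mkₐ k _ := by
      refine algHom_ext fun i => ?_
      by_cases hi : i ∈ s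
      · have : X i ∈ Ideal.span (X '' s : Set (MvPolynomial σ k)) :=
          Ideal.subset_span ⟨i, hi, rfl⟩
        simpa [hφ, hi] using (Ideal.Quotient.eq_zero_iff_mem.mpr this).symm
      · simp [hφ, hi]
    have h := DFunLike.congr_fun hmk p
    rw [AlgHom.comp_apply, show φ p = 0 from hp, map_zero] at h
    exact Ideal.Quotient.eq_zero_iff_mem.mp h.symm

/-- The irrelevant ideal of a polynomial ring in `n` variables has height at least `n`. -/
theorem le_height_span_range_X {k : Type*} [CommRing k] [IsDomain k] (n : ℕ) :
    (n : ℕ∞) ≤ (Ideal.span (Set.range (X : Fin n → MvPolynomial (Fin n) k))).height := by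
  have key : ∀ j : ℕ, j ≤ n →
      (j : ℕ∞) ≤ (Ideal.span (X '' {i : Fin n | (i : ℕ) < j} :
        Set (MvPolynomial (Fin n) k))).height := by
    intro j
    induction j with
    | zero => simp
    | succ j ih =>
      intro hj
      have := isPrime_span_X_image (k := k) {i : Fin n | (i : ℕ) < j}
      have := isPrime_span_X_image (k := k) {i : Fin n | (i : ℕ) < j + 1}
      have hlt : Ideal.span (X '' {i : Fin n | (i : ℕ) < j} : Set (MvPolynomial (Fin n) k)) <
          Ideal.span (X '' {i : Fin n | (i : ℕ) < j + 1}) := by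
        refine lt_of_le_not_ge (Ideal.span_mono (Set.image_mono fun i (hi : (i : ℕ) < j) =>
          Nat.lt_succ_of_lt hi)) fun hle => ?_
        have hmem : (X ⟨j, hj⟩ : MvPolynomial (Fin n) k) ∈
            Ideal.span (X '' {i : Fin n | (i : ℕ) < j}) :=
          hle (Ideal.subset_span ⟨⟨j, hj⟩, Nat.lt_succ_self j, rfl⟩)
        rw [mem_ideal_span_X_image] at hmem
        obtain ⟨i, hi, hne⟩ := hmem (Finsupp.single ⟨j, hj⟩ 1) (by simp [support_X])
        refine hne (Finsupp.single_eq_of_ne ?_)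
        rintro rfl
        exact lt_irrefl j hi
      push_cast
      exact (add_le_add_left (ih (by omega)) 1).trans (Ideal.height_add_one_le_of_lt_of_isPrime hlt)
  have huniv : {i : Fin n | (i : ℕ) < n} = Set.univ := by
    ext i
    simp
  simpa [huniv] using key n le_rfl

/-- The chain rule for a linear substitution. -/
theorem pderiv_substGL {k : Type*} [CommRing k] {n : ℕ} (g : Matrix (Fin n) (Fin n) k)
    (F : MvPolynomial (Fin n) k) (i : Fin n) :
    pderiv i (substGL g F) = ∑ j, C (g j i) * substGL g (pderiv j F) := by
  classical
  unfold substGL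
  induction F using MvPolynomial.induction_on with
  | C a => simp
  | add p q hp hq => simp only [map_add, hp, hq, mul_add, Finset.sum_add_distrib]
  | mul_X p l hp =>
    rw [map_mul, aeval_X, pderiv_mul, hp]
    simp only [pderiv_mul, map_add, map_mul, aeval_X, mul_add, Finset.sum_add_distrib,
      Finset.sum_mul, mul_assoc]
    congr 1
    simp [pderiv_X, Pi.single_apply, mul_comm]

theorem substGL_substGL {k : Type*} [CommRing k] {n : ℕ} (g h : Matrix (Fin n) (Fin n) k)
    (F : MvPolynomial (Fin n) k) : substGL g (substGL h F) = substGL (h * g) F := by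
  have : (aeval fun i => ∑ j, C (g i j) * X j : MvPolynomial (Fin n) k →ₐ[k] _).comp
      (aeval fun i => ∑ j, C (h i j) * X j) = aeval fun i => ∑ j, C ((h * g) i j) * X j := by
    refine algHom_ext fun i => ?_
    simp only [AlgHom.comp_apply, aeval_X, map_sum, map_mul, algHom_C, Matrix.mul_apply,
      Finset.mul_sum, Finset.sum_mul, algebraMap_eq]
    rw [Finset.sum_comm]
    simp only [mul_assoc]
  exact DFunLike.congr_fun this F

theorem substGL_one {k : Type*} [CommRing k] {n : ℕ} (F : MvPolynomial (Fin n) k) :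
    substGL 1 F = F := by
  simp [substGL, Matrix.one_apply]

theorem substGL_isHomogeneous {k : Type*} [CommRing k] {n d : ℕ} (g : Matrix (Fin n) (Fin n) k)
    {F : MvPolynomial (Fin n) k} (hF : F.IsHomogeneous d) : (substGL g F).IsHomogeneous d := by
  have h := hF.aeval (fun i => ∑ j, C (g i j) * X j)
    (fun i => IsHomogeneous.sum _ _ 1 fun j _ => isHomogeneous_C_mul_X _ _)
  rwa [one_mul] at h

/-- The dimension of the singular locus does not increase under a linear change of coordinates. -/
theorem ringKrullDim_quotient_jacobianIdeal_substGL_le {k : Type*} [CommRing k] {N : ℕ}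
    {g h : Matrix (Fin (N + 1)) (Fin (N + 1)) k} (hgh : g * h = 1)
    (F : MvPolynomial (Fin (N + 1)) k) :
    ringKrullDim (MvPolynomial (Fin (N + 1)) k ⧸ jacobianIdeal (substGL g F)) ≤
      ringKrullDim (MvPolynomial (Fin (N + 1)) k ⧸ jacobianIdeal F) := by
  let φ : MvPolynomial (Fin (N + 1)) k →ₐ[k] MvPolynomial (Fin (N + 1)) k :=
    aeval fun i => ∑ j, C (g i j) * X j
  have hφ : ∀ P, φ P = substGL g P := fun _ => rfl
  have hsurj : Function.Surjective φ := fun P => by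
    refine ⟨substGL h P, ?_⟩
    rw [hφ, substGL_substGL, mul_eq_one_comm.mp hgh, substGL_one]
  have hmem : ∀ i, φ (pderiv i F) ∈ jacobianIdeal (substGL g F) := fun i => by
    have hsum : φ (pderiv i F) = ∑ j, C (h j i) * pderiv j (substGL g F) := by
      simp only [pderiv_substGL, Finset.mul_sum, ← mul_assoc, ← C_mul]
      rw [Finset.sum_comm]
      simp only [← Finset.sum_mul, ← map_sum, mul_comm (h _ _), ← Matrix.mul_apply, hgh]
      simp [Matrix.one_apply, hφ]
    rw [hsum]
    exact Ideal.sum_mem _ fun j _ => Ideal.mul_mem_left _ _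
      (Ideal.subset_span (Or.inr ⟨j, rfl⟩))
  have hle : jacobianIdeal F ≤ (jacobianIdeal (substGL g F)).comap φ := by
    refine Ideal.span_le.mpr ?_
    rintro _ (rfl | ⟨i, rfl⟩)
    · exact Ideal.subset_span (Or.inl rfl)
    · exact hmem i
  exact ringKrullDim_le_of_surjective (Ideal.quotientMap _ φ.toRingHom hle)
    (Ideal.quotientMap_surjective hsurj)

theorem sum_mul_le_adeg {k : Type*} [CommSemiring k] {n : ℕ} (α : Fin n → ℤ)
    {G : MvPolynomial (Fin n) k} {m : Fin n →₀ ℕ} (hm : m ∈ G.support) :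
    ∑ i, (m i : ℤ) * α i ≤ adeg α G := by
  rw [adeg, dif_pos ⟨m, hm⟩]
  exact Finset.le_sup' (fun m : Fin n →₀ ℕ => ∑ i, (m i : ℤ) * α i) hm

/-- A weighted degree is at least `degree m * α u` when only variables of index at least `u`
occur. -/
theorem degree_mul_le_sum_mul {n : ℕ} {α : Fin n → ℤ} (hα : Monotone α) {u : Fin n}
    {m : Fin n →₀ ℕ} (hm : ∀ i < u, m i = 0) :
    (m.degree : ℤ) * α u ≤ ∑ i, (m i : ℤ) * α i := by
  rw [Finsupp.degree_eq_sum, Nat.cast_sum, Finset.sum_mul]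
  refine Finset.sum_le_sum fun i _ => ?_
  rcases lt_or_ge i u with hi | hi
  · simp [hm i hi]
  · exact mul_le_mul_of_nonneg_left (hα hi) (by positivity)

/-- If the singular locus of `G` is too small, some monomial of `G` has large weight: otherwise
`G` would be singular on the locus cut out by the `X i`, `i < u`, and the `∂G/∂X i`, `i < v`. -/
theorem weight_le_adeg_of_ringKrullDim_lt {k : Type*} [Field k] {N d : ℕ} (hd : 2 ≤ d)
    {G : MvPolynomial (Fin (N + 1)) k} (hG : G.IsHomogeneous d)
    {α : Fin (N + 1) → ℤ} (hα : Monotone α) {u v : Fin (N + 1)} (hvu : v ≤ u) {e : ℕ}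
    (hdim : ringKrullDim (MvPolynomial (Fin (N + 1)) k ⧸ jacobianIdeal G) ≤ (e : WithBot ℕ∞))
    (he : e + (u + v) < N + 1) :
    (d - 1 : ℤ) * α u + α v ≤ adeg α G := by
  by_contra! hlt
  let A : Set (MvPolynomial (Fin (N + 1)) k) := X '' Set.Iio u
  let B : Set (MvPolynomial (Fin (N + 1)) k) := (fun i => pderiv i G) '' Set.Iio v
  have hGmem : G ∈ Ideal.span A := by
    refine mem_ideal_span_X_image.mpr fun m hm => ?_
    by_contra! hm0
    have h1 := sum_mul_le_adeg α hm
    have h2 := degree_mul_le_sum_mul hα (u := u) hm0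
    have h3 : m.degree = d := by
      by_contra h
      exact (mem_support_iff.mp hm) (hG.coeff_eq_zero h)
    rw [h3] at h2
    linarith [hα hvu]
  have hpderiv : ∀ i, v ≤ i → pderiv i G ∈ Ideal.span A := fun i hi => by
    refine mem_ideal_span_X_image.mpr fun m hm => ?_
    by_contra! hm0
    have hdeg : m.degree = d - 1 := by
      by_contra h
      exact (mem_support_iff.mp hm) (hG.pderiv.coeff_eq_zero h)
    have hmG : m + Finsupp.single i 1 ∈ G.support := by
      rw [mem_support_iff, coeff_pderiv] at hm
      exact mem_support_iff.mpr (left_ne_zero_of_mul hm)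
    have h1 := sum_mul_le_adeg α hmG
    have h2 := degree_mul_le_sum_mul hα (u := u) hm0
    have h3 : ∑ j, (((m + Finsupp.single i 1 : Fin (N + 1) →₀ ℕ) j : ℕ) : ℤ) * α j = (∑ j, (m j : ℤ) * α j) + α i := by
      simp [add_mul, Finset.sum_add_distrib, Finsupp.single_apply]
    rw [hdeg, Nat.cast_sub (by omega)] at h2
    push_cast at h2
    linarith [hα hi]
  have hJ : jacobianIdeal G ≤ Ideal.span (A ∪ B) := by
    have hA : Ideal.span A ≤ Ideal.span (A ∪ B) := Ideal.span_mono Set.subset_union_left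
    refine Ideal.span_le.mpr ?_
    rintro _ (rfl | ⟨i, rfl⟩)
    · exact hA hGmem
    · rcases lt_or_ge i v with hi | hi
      · exact Ideal.subset_span (Or.inr ⟨i, hi, rfl⟩)
      · exact hA (hpderiv i hi)
  have hprime : (Ideal.span (Set.range (X : _ → MvPolynomial (Fin (N + 1)) k))).IsPrime := by
    simpa using isPrime_span_X_image (k := k) (Set.univ : Set (Fin (N + 1)))
  have hsub : A ∪ B ⊆ Ideal.span (Set.range (X : _ → MvPolynomial (Fin (N + 1)) k)) := by
    rintro _ (⟨i, -, rfl⟩ | ⟨i, -, rfl⟩)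
    · exact Ideal.subset_span ⟨i, rfl⟩
    · rw [SetLike.mem_coe, ← Set.image_univ, mem_ideal_span_X_image]
      intro m hm
      by_contra! hm0
      have hm' : m = 0 := Finsupp.ext fun j => hm0 j trivial
      refine (mem_support_iff.mp hm) (hG.pderiv.coeff_eq_zero ?_)
      rw [hm', map_zero]
      omega
  have hcard : (A ∪ B).encard ≤ ((u + v : ℕ) : ℕ∞) := by
    refine (Set.encard_union_le _ _).trans ?_
    push_cast
    refine add_le_add ((Set.encard_image_le _ _).trans ?_) ((Set.encard_image_le _ _).trans ?_) <;>
      simp [Set.encard_eq_coe_toFinset_card]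
  have hquot : ringKrullDim (MvPolynomial (Fin (N + 1)) k ⧸ Ideal.span (A ∪ B)) ≤ e :=
    (ringKrullDim_le_of_surjective (Ideal.Quotient.factor hJ)
      (Ideal.Quotient.factor_surjective hJ)).trans hdim
  have hheight : ((N + 1 : ℕ) : WithBot ℕ∞) ≤ (e : WithBot ℕ∞) + ((u + v : ℕ) : WithBot ℕ∞) :=
    calc ((N + 1 : ℕ) : WithBot ℕ∞)
      _ ≤ _ := WithBot.coe_le_coe.mpr (le_height_span_range_X (k := k) (N + 1))
      _ ≤ _ := Ideal.height_le_ringKrullDim_quotient_add_encard (A ∪ B) hsub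
      _ ≤ _ := add_le_add hquot (WithBot.coe_le_coe.mpr hcard)
  have : N + 1 ≤ e + (u + v) := by exact_mod_cast hheight
  omega

/-- If `dim H_sing ≤ s ≤ N - 2`, then
`(N - s - 2) · deg_α (F∘g) ≥ d · ∑_{i=1}^{N-s-2} α_i`. -/
theorem adeg_sum_ge_of_dim_singular_le {k : Type*} [Field k] [IsAlgClosed k]
    {N d : ℕ} (hN : 1 ≤ N) (hd : 2 ≤ d)
    (F : MvPolynomial (Fin (N+1)) k) (hF0 : F ≠ 0) (hFhom : F.IsHomogeneous d)
    (g : Matrix.GeneralLinearGroup (Fin (N+1)) k)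
    (α : Fin (N+1) → ℤ) (hα0 : α ≠ 0) (hmono : Monotone α) (hsum : ∑ i, α i = 0)
    (s : ℤ) (hs : -1 ≤ s) (hsN : s ≤ (N : ℤ) - 2)
    (hsing : ringKrullDim (MvPolynomial (Fin (N+1)) k ⧸ jacobianIdeal F)
      ≤ ((s+1).toNat : WithBot ℕ∞)) :
    (d : ℤ) * (∑ i ∈ Finset.univ.filter
        (fun i : Fin (N+1) => 1 ≤ (i : ℕ) ∧ (i : ℤ) ≤ (N : ℤ) - s - 2), α i)
      ≤ ((N : ℤ) - s - 2) * adeg α (substGL (↑g) F) := by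
  obtain ⟨r, hr⟩ : ∃ r : ℕ, (N : ℤ) - s - 2 = r := ⟨_, (Int.toNat_of_nonneg (by omega)).symm⟩
  set c := adeg α (substGL (↑g) F)
  have hweight : ∀ u v : Fin (N + 1), (u : ℕ) + v = r + 1 → (d - 1 : ℤ) * α u + α v ≤ c := by
    intro u v huv
    have hdim := (ringKrullDim_quotient_jacobianIdeal_substGL_le g.mul_inv F).trans hsing
    have hhom := substGL_isHomogeneous (g : Matrix _ _ k) hFhom
    rcases le_total v u with h | h
    · exact weight_le_adeg_of_ringKrullDim_lt hd hhom hmono h hdim (by omega)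
    · have hle := weight_le_adeg_of_ringKrullDim_lt hd hhom hmono h hdim (by omega)
      have hd' : (2 : ℤ) ≤ d := by exact_mod_cast hd
      nlinarith [mul_nonneg (sub_nonneg.mpr hd') (sub_nonneg.mpr (hmono h))]
  let a : ℕ → ℤ := fun j => α (Fin.ofNat (N + 1) (j + 1))
  have hval : ∀ j < r, ((Fin.ofNat (N + 1) (j + 1) : Fin (N + 1)) : ℕ) = j + 1 := fun j hj =>
    Nat.mod_eq_of_lt (by omega)
  have hsum_eq : ∑ i ∈ Finset.univ.filter
      (fun i : Fin (N + 1) => 1 ≤ (i : ℕ) ∧ (i : ℤ) ≤ (N : ℤ) - s - 2), α i =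
        ∑ j ∈ Finset.range r, a j := by
    refine Finset.sum_bij' (fun i _ => (i : ℕ) - 1) (fun j _ => Fin.ofNat (N + 1) (j + 1))
      ?_ ?_ ?_ ?_ ?_
    · intro i hi
      simp only [Finset.mem_filter, Finset.mem_univ, true_and, Finset.mem_range] at hi ⊢
      omega
    · intro j hj
      have := hval j (Finset.mem_range.mp hj)
      have := Finset.mem_range.mp hj
      simp only [Finset.mem_filter, Finset.mem_univ, true_and]
      omega
    · intro i hi
      simp only [Finset.mem_filter, Finset.mem_univ, true_and] at hi
      refine Fin.ext ((hval _ (by omega)).trans (by omega))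
    · intro j hj
      have := hval j (Finset.mem_range.mp hj)
      omega
    · intro i hi
      simp only [Finset.mem_filter, Finset.mem_univ, true_and] at hi
      refine congrArg α (Fin.ext ?_)
      have := hval ((i : ℕ) - 1) (by omega)
      omega
  rw [hsum_eq, hr]
  calc (d : ℤ) * ∑ j ∈ Finset.range r, a j
    _ = ∑ j ∈ Finset.range r, ((d - 1 : ℤ) * a j + a (r - 1 - j)) := by
      rw [Finset.sum_add_distrib, Finset.sum_range_reflect, ← Finset.mul_sum]
      ring
    _ ≤ ∑ j ∈ Finset.range r, c := by
      refine Finset.sum_le_sum fun j hj => hweight _ _ ?_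
      have := Finset.mem_range.mp hj
      rw [hval j this, hval (r - 1 - j) (by omega)]
      omega
    _ = r * c := by simp
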